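/- arXiv:2106.03320 — 7 statements merged into one kernel-verified Lean document; each statement's English description precedes it below -/
import Mathlib

section
/- Suppose Z ∈ S_{n,p}, X_i ∈ S_{n,p} with X_iX_iᵀ = ZZᵀ for i = 1,…,d, and R ∈ ℝ^{n×p} satisfies P_Z(−AAᵀZ + R) = 0 and ZᵀR = RᵀZ. Define Θ := ZᵀR, Γ_i := −X_iᵀ A_i A_iᵀ X_i, and Λ_i := −P_{X_i} A_i A_iᵀ X_iX_iᵀ − X_iX_iᵀ A_i A_iᵀ P_{X_i}. Then Θ, each Γ_i, and each Λ_i are symmetric, and the KKT system holds: A_i A_iᵀ X_i + X_i Γ_i + Λ_i X_i = 0 for every i, and R + ∑_{i=1}^d Λ_i Z − Z Θ = 0. -/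
open Matrix BigOperators

/-- The low-rank multiplier built from a matrix `M` and the projection `Y * Yᵀ` acts on
`Y` as minus the projection of `M * Y` onto the orthogonal complement of the range of `Y`. -/
theorem lowRankMultiplier_mul_self {ι κ : Type*} [Fintype ι] [DecidableEq ι] [Fintype κ]
    [DecidableEq κ] (M : Matrix ι ι ℝ) {Y : Matrix ι κ ℝ} (hY : Yᵀ * Y = 1) :
    (-((1 - Y * Yᵀ) * M * (Y * Yᵀ)) - (Y * Yᵀ) * M * (1 - Y * Yᵀ)) * Y
      = -((1 - Y * Yᵀ) * (M * Y)) := by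
  have hproj : Y * Yᵀ * Y = Y := by rw [Matrix.mul_assoc, hY, Matrix.mul_one]
  have hcompl : (1 - Y * Yᵀ) * Y = 0 := by rw [Matrix.sub_mul, Matrix.one_mul, hproj, sub_self]
  rw [Matrix.sub_mul, Matrix.neg_mul, Matrix.mul_assoc _ (Y * Yᵀ) Y, hproj,
    Matrix.mul_assoc _ (1 - Y * Yᵀ) Y, hcompl, Matrix.mul_zero, sub_zero, Matrix.mul_assoc]

/-- at a first-order stationary point of the sparse PCA problem
(with the subspace-consensus constraints holding), the explicit multipliers
`Θ := ZᵀR`, `Γ_i := −X_iᵀA_iA_iᵀX_i` and the low-rank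
`Λ_i := −P_{X_i}A_iA_iᵀX_iX_iᵀ − X_iX_iᵀA_iA_iᵀP_{X_i}` are symmetric and
satisfy the KKT system. -/
theorem stmt1 {n p d : ℕ} {m : Fin d → ℕ}
    (Z : Matrix (Fin n) (Fin p) ℝ)
    (X : Fin d → Matrix (Fin n) (Fin p) ℝ)
    (A : (i : Fin d) → Matrix (Fin n) (Fin (m i)) ℝ)
    (R : Matrix (Fin n) (Fin p) ℝ)
    (hZ : Zᵀ * Z = 1)
    (hX : ∀ i, (X i)ᵀ * X i = 1)
    (hcons : ∀ i, X i * (X i)ᵀ = Z * Zᵀ)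
    (hstat1 : (1 - Z * Zᵀ) * (-((∑ i, A i * (A i)ᵀ) * Z) + R) = 0)
    (hstat2 : Zᵀ * R = Rᵀ * Z) :
    -- symmetry of Θ := ZᵀR
    (Zᵀ * R)ᵀ = Zᵀ * R
    -- symmetry of Γ_i := −X_iᵀ A_i A_iᵀ X_i
    ∧ (∀ i, (-((X i)ᵀ * (A i * (A i)ᵀ) * X i))ᵀ = -((X i)ᵀ * (A i * (A i)ᵀ) * X i))
    -- symmetry of Λ_i
    ∧ (∀ i, (-((1 - X i * (X i)ᵀ) * (A i * (A i)ᵀ) * (X i * (X i)ᵀ))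
              - (X i * (X i)ᵀ) * (A i * (A i)ᵀ) * (1 - X i * (X i)ᵀ))ᵀ
            = -((1 - X i * (X i)ᵀ) * (A i * (A i)ᵀ) * (X i * (X i)ᵀ))
              - (X i * (X i)ᵀ) * (A i * (A i)ᵀ) * (1 - X i * (X i)ᵀ))
    -- first KKT equation
    ∧ (∀ i, A i * (A i)ᵀ * X i + X i * (-((X i)ᵀ * (A i * (A i)ᵀ) * X i))
          + (-((1 - X i * (X i)ᵀ) * (A i * (A i)ᵀ) * (X i * (X i)ᵀ))
              - (X i * (X i)ᵀ) * (A i * (A i)ᵀ) * (1 - X i * (X i)ᵀ)) * X i = 0)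
    -- second KKT equation
    ∧ R + (∑ i, (-((1 - X i * (X i)ᵀ) * (A i * (A i)ᵀ) * (X i * (X i)ᵀ))
              - (X i * (X i)ᵀ) * (A i * (A i)ᵀ) * (1 - X i * (X i)ᵀ))) * Z
        - Z * (Zᵀ * R) = 0 := by
  refine ⟨?_, fun i => ?_, fun i => ?_, fun i => ?_, ?_⟩
  · rw [transpose_mul, transpose_transpose, hstat2]
  · simp only [transpose_neg, transpose_mul, transpose_transpose, Matrix.mul_assoc]
  · simp only [transpose_sub, transpose_neg, transpose_mul, transpose_transpose, transpose_one,
      Matrix.mul_assoc]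
    abel
  · rw [lowRankMultiplier_mul_self _ (hX i)]
    simp only [Matrix.sub_mul, Matrix.one_mul, Matrix.mul_neg, Matrix.mul_assoc]
    abel
  · simp only [hcons]
    have hsum : (∑ i, (-((1 - Z * Zᵀ) * (A i * (A i)ᵀ) * (Z * Zᵀ))
        - (Z * Zᵀ) * (A i * (A i)ᵀ) * (1 - Z * Zᵀ))) * Z
        = -((1 - Z * Zᵀ) * ((∑ i, A i * (A i)ᵀ) * Z)) := by
      simp only [Matrix.sum_mul, Matrix.mul_sum, lowRankMultiplier_mul_self _ hZ,
        Finset.sum_neg_distrib]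
    rw [hsum, ← hstat1, Matrix.mul_add, Matrix.mul_neg, Matrix.sub_mul 1 _ R, Matrix.one_mul,
      Matrix.mul_assoc Z Zᵀ R]
    abel
end

section
/- Suppose Z ∈ S_{n,p} and X_i ∈ S_{n,p} with X_iX_iᵀ = ZZᵀ for i = 1,…,d, and suppose there exist symmetric matrices Λ_i ∈ ℝ^{n×n}, Γ_i ∈ ℝ^{p×p}, Θ ∈ ℝ^{p×p} and a matrix R ∈ ℝ^{n×p} such that A_i A_iᵀ X_i + X_i Γ_i + Λ_i X_i = 0 for every i and R + ∑_{i=1}^d Λ_i Z − Z Θ = 0. Then P_Z(−AAᵀZ + R) = 0 and ZᵀR = RᵀZ. -/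
open Matrix BigOperators

/-- if the KKT system of the subspace-splitting model holds at a feasible
point (with symmetric multipliers), then the first-order stationarity conditions of the
sparse PCA problem hold at `Z`. -/
theorem stmt2 {n p d : ℕ} {m : Fin d → ℕ}
    (Z : Matrix (Fin n) (Fin p) ℝ)
    (X : Fin d → Matrix (Fin n) (Fin p) ℝ)
    (A : (i : Fin d) → Matrix (Fin n) (Fin (m i)) ℝ)
    (R : Matrix (Fin n) (Fin p) ℝ)
    (Λ : Fin d → Matrix (Fin n) (Fin n) ℝ)
    (Γ : Fin d → Matrix (Fin p) (Fin p) ℝ)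
    (Θ : Matrix (Fin p) (Fin p) ℝ)
    (hZ : Zᵀ * Z = 1)
    (hX : ∀ i, (X i)ᵀ * X i = 1)
    (hcons : ∀ i, X i * (X i)ᵀ = Z * Zᵀ)
    (hΛsym : ∀ i, (Λ i)ᵀ = Λ i)
    (hΓsym : ∀ i, (Γ i)ᵀ = Γ i)
    (hΘsym : Θᵀ = Θ)
    (hkkt1 : ∀ i, A i * (A i)ᵀ * X i + X i * Γ i + Λ i * X i = 0)
    (hkkt2 : R + (∑ i, Λ i) * Z - Z * Θ = 0) :
    (1 - Z * Zᵀ) * (-((∑ i, A i * (A i)ᵀ) * Z) + R) = 0 ∧ Zᵀ * R = Rᵀ * Z := by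
  have hR : R = Z * Θ - (∑ i, Λ i) * Z := by
    rw [eq_sub_iff_add_eq]
    exact sub_eq_zero.mp hkkt2
  have hPZ : (1 - Z * Zᵀ) * Z = 0 := by
    rw [Matrix.sub_mul, Matrix.one_mul, Matrix.mul_assoc, hZ, Matrix.mul_one, sub_self]
  have hPX : ∀ i, (1 - Z * Zᵀ) * X i = 0 := fun i => by
    rw [← hcons i, Matrix.sub_mul, Matrix.one_mul, Matrix.mul_assoc, hX, Matrix.mul_one,
      sub_self]
  -- Multiplying the `i`-th equation on the right by `(X i)ᵀ * Z` turns `X i` into `Z`.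
  have hXZ : ∀ i, X i * ((X i)ᵀ * Z) = Z := fun i => by
    rw [← Matrix.mul_assoc, hcons i, Matrix.mul_assoc, hZ, Matrix.mul_one]
  have hblock : ∀ i, (1 - Z * Zᵀ) * ((A i * (A i)ᵀ + Λ i) * Z) = 0 := fun i => by
    have hAΛ : (A i * (A i)ᵀ + Λ i) * X i = -(X i * Γ i) := by
      rw [eq_neg_iff_add_eq_zero, Matrix.add_mul, ← hkkt1 i]
      abel
    rw [← hXZ i, ← Matrix.mul_assoc (A i * (A i)ᵀ + Λ i), hAΛ, hXZ i, Matrix.neg_mul,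
      Matrix.mul_neg, Matrix.mul_assoc (X i), ← Matrix.mul_assoc, hPX i, Matrix.zero_mul,
      neg_zero]
  constructor
  · have hsplit : -((∑ i, A i * (A i)ᵀ) * Z) + R
        = Z * Θ - ∑ i, (A i * (A i)ᵀ + Λ i) * Z := by
      rw [hR, ← Matrix.sum_mul, Finset.sum_add_distrib, Matrix.add_mul]
      abel
    rw [hsplit, Matrix.mul_sub, ← Matrix.mul_assoc, hPZ, Matrix.zero_mul, Matrix.mul_sum,
      Finset.sum_eq_zero fun i _ => hblock i, sub_zero]
  · have hΛ : (∑ i, Λ i)ᵀ = ∑ i, Λ i := by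
      simp only [Matrix.transpose_sum, hΛsym]
    rw [hR, Matrix.transpose_sub, Matrix.transpose_mul, Matrix.transpose_mul, hΘsym, hΛ,
      Matrix.mul_sub, Matrix.sub_mul, ← Matrix.mul_assoc, hZ, Matrix.one_mul,
      Matrix.mul_assoc Θ, hZ, Matrix.mul_one, Matrix.mul_assoc]
end

section
/- Let Z ∈ S_{n,p} and X_i ∈ S_{n,p} with X_iX_iᵀ = ZZᵀ for i = 1,…,d (a feasible point). Let Λ_i := Λ(X_i;A_i), Q := ∑_{i=1}^d (Λ_i − β_i X_i X_iᵀ) with β_i > 0, η > 0, and μ > 0. If D = 0 is a minimizer of g(D) := ⟨QZ, D⟩ + (1/(2η))‖D‖²_F + μ∑_{i,j}|(Z+D)_{ij}| over the tangent space {D ∈ ℝ^{n×p} : DᵀZ + ZᵀD = 0}, then Z is a first-order stationary point of the ℓ1-regularized sparse PCA problem. -/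
open Matrix BigOperators

/-- Frobenius norm of a real matrix. -/
noncomputable def frob {n m : ℕ} (A : Matrix (Fin n) (Fin m) ℝ) : ℝ :=
  Real.sqrt (∑ i, ∑ j, (A i j) ^ 2)

/-- The low-rank multiplier `Λ(X;A) = XW(X;A)ᵀ + W(X;A)Xᵀ` with
`W(X;A) = −(I − XXᵀ)AAᵀX`. -/
noncomputable def LamW {n p m : ℕ} (X : Matrix (Fin n) (Fin p) ℝ)
    (A : Matrix (Fin n) (Fin m) ℝ) : Matrix (Fin n) (Fin n) ℝ :=
  X * (-((1 - X * Xᵀ) * (A * Aᵀ) * X))ᵀ + (-((1 - X * Xᵀ) * (A * Aᵀ) * X)) * Xᵀ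

/-- `R` belongs to the subdifferential of `Z ↦ μ ∑_{i,j} |Z_{ij}|` at `Z`. -/
def subdiffL1 {n p : ℕ} (μ : ℝ) (Z R : Matrix (Fin n) (Fin p) ℝ) : Prop :=
  ∀ i j, (Z i j ≠ 0 → R i j = μ * Real.sign (Z i j)) ∧ (Z i j = 0 → |R i j| ≤ μ)

/-- The one-sided directional derivative of the absolute value at `z` in direction `x`. -/
noncomputable def absDirDeriv (z x : ℝ) : ℝ :=
  if z = 0 then |x| else Real.sign z * x

lemma absDirDeriv_mul {c : ℝ} (hc : 0 < c) (z x : ℝ) :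
    absDirDeriv z (c * x) = c * absDirDeriv z x := by
  unfold absDirDeriv
  split_ifs
  · rw [abs_mul, abs_of_pos hc]
  · ring

lemma absDirDeriv_add_le (z x y : ℝ) :
    absDirDeriv z (x + y) ≤ absDirDeriv z x + absDirDeriv z y := by
  unfold absDirDeriv
  split_ifs
  · exact abs_add_le x y
  · rw [mul_add]

lemma absDirDeriv_zero (z : ℝ) : absDirDeriv z 0 = 0 := by
  simp [absDirDeriv]

lemma abs_add_mul_le {t : ℝ} (ht : 0 ≤ t) (z x : ℝ) :
    |z + t * x| ≤ |z| + t * absDirDeriv z x + t ^ 2 * (x ^ 2 / (2 * |z|)) := by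
  unfold absDirDeriv
  split_ifs with hz
  · simp [hz, abs_mul, abs_of_nonneg ht]
  · have hpos : 0 < |z| := abs_pos.mpr hz
    have hsign : Real.sign z * |z| = z := by
      rcases lt_or_gt_of_ne hz with h | h
      · rw [Real.sign_of_neg h, abs_of_neg h]; ring
      · rw [Real.sign_of_pos h, abs_of_pos h]; ring
    have hquad : 2 * |z| * |z + t * x| ≤ z ^ 2 + (z + t * x) ^ 2 := by
      nlinarith [sq_nonneg (|z| - |z + t * x|), sq_abs z, sq_abs (z + t * x)]
    have hrhs : 2 * |z| * (|z| + t * (Real.sign z * x) + t ^ 2 * (x ^ 2 / (2 * |z|)))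
        = z ^ 2 + (z + t * x) ^ 2 := by
      calc _ = 2 * |z| ^ 2 + 2 * t * x * (Real.sign z * |z|)
            + t ^ 2 * (x ^ 2 / (2 * |z|) * (2 * |z|)) := by ring
        _ = _ := by
          rw [hsign, div_mul_cancel₀ _ (by positivity), sq_abs]; ring
    exact le_of_mul_le_mul_left (hquad.trans_eq hrhs.symm) (by positivity)

lemma nonneg_of_forall_pos_mul_add_sq {a c : ℝ}
    (h : ∀ t : ℝ, 0 < t → 0 ≤ t * a + t ^ 2 * c) : 0 ≤ a := by
  by_contra! ha
  have hc : 0 < |c| + 1 := by positivity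
  set t := -a / (2 * (|c| + 1)) with ht_def
  have ht : 0 < t := div_pos (by linarith) (by positivity)
  have hta : t * (|c| + 1) = -a / 2 := by rw [ht_def]; field_simp
  have h1 := h t ht
  have h2 : t * c ≤ t * (|c| + 1) :=
    mul_le_mul_of_nonneg_left (by linarith [le_abs_self c]) ht.le
  nlinarith

/-- The directional derivative of the entrywise `ℓ1` norm at `Z` in direction `D`. -/
noncomputable def l1DirDeriv {n p : ℕ} (Z D : Matrix (Fin n) (Fin p) ℝ) : ℝ :=
  ∑ a, ∑ b, absDirDeriv (Z a b) (D a b)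

/-- First-order optimality of `0` for a proximal-linear model on a subspace. -/
lemma nonneg_dirDeriv_of_isMin {n p : ℕ} {μ c : ℝ} (hμ : 0 ≤ μ)
    (Z G : Matrix (Fin n) (Fin p) ℝ) (T : Submodule ℝ (Matrix (Fin n) (Fin p) ℝ))
    (hmin : ∀ D ∈ T, μ * ∑ a, ∑ b, |Z a b| ≤
      (Gᵀ * D).trace + c * ∑ a, ∑ b, D a b ^ 2 + μ * ∑ a, ∑ b, |Z a b + D a b|)
    {D : Matrix (Fin n) (Fin p) ℝ} (hD : D ∈ T) :
    0 ≤ (Gᵀ * D).trace + μ * l1DirDeriv Z D := by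
  refine nonneg_of_forall_pos_mul_add_sq
    (c := c * ∑ a, ∑ b, D a b ^ 2 + μ * ∑ a, ∑ b, D a b ^ 2 / (2 * |Z a b|)) fun t ht => ?_
  have h := hmin (t • D) (T.smul_mem t hD)
  have habs : ∑ a, ∑ b, |Z a b + (t • D) a b| ≤ ∑ a, ∑ b, |Z a b| + t * l1DirDeriv Z D
      + t ^ 2 * ∑ a, ∑ b, D a b ^ 2 / (2 * |Z a b|) := by
    simp only [l1DirDeriv, Finset.mul_sum, ← Finset.sum_add_distrib]
    exact Finset.sum_le_sum fun a _ => Finset.sum_le_sum fun b _ => by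
      simpa using abs_add_mul_le ht.le (Z a b) (D a b)
  have hsq : ∑ a, ∑ b, (t • D) a b ^ 2 = t ^ 2 * ∑ a, ∑ b, D a b ^ 2 := by
    simp only [Finset.mul_sum, Matrix.smul_apply, smul_eq_mul, mul_pow]
  rw [hsq, Matrix.mul_smul, Matrix.trace_smul, smul_eq_mul] at h
  have := mul_le_mul_of_nonneg_left habs hμ
  linarith

lemma l1DirDeriv_single {n p : ℕ} (Z : Matrix (Fin n) (Fin p) ℝ) (i : Fin n) (j : Fin p)
    (x : ℝ) : l1DirDeriv Z (Matrix.single i j x) = absDirDeriv (Z i j) x := by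
  unfold l1DirDeriv
  rw [Finset.sum_eq_single i, Finset.sum_eq_single j]
  · simp
  · intro b _ hb
    simp [hb.symm, absDirDeriv_zero]
  · simp
  · intro a _ ha
    simp [ha.symm, absDirDeriv_zero]
  · simp

/-- A linear functional whose sum with the directional derivative of the `ℓ1` penalty is
nonnegative on a subspace is cancelled there by a subgradient of the penalty. -/
lemma exists_subdiffL1_of_nonneg {n p : ℕ} {μ : ℝ} (hμ : 0 ≤ μ)
    (Z G : Matrix (Fin n) (Fin p) ℝ) (T : Submodule ℝ (Matrix (Fin n) (Fin p) ℝ))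
    (h : ∀ D ∈ T, 0 ≤ (Gᵀ * D).trace + μ * l1DirDeriv Z D) :
    ∃ R, subdiffL1 μ Z R ∧ ∀ D ∈ T, ((G + R)ᵀ * D).trace = 0 := by
  let φ : Matrix (Fin n) (Fin p) ℝ →ₗ[ℝ] ℝ :=
    { toFun := fun D => -(Gᵀ * D).trace
      map_add' := fun D E => by rw [Matrix.mul_add, Matrix.trace_add, neg_add]
      map_smul' := fun c D => by simp }
  obtain ⟨g, hgT, hgN⟩ := exists_extension_of_le_sublinear ⟨T, φ.comp T.subtype⟩
    (fun D => μ * l1DirDeriv Z D)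
    (fun c hc D => by
      simp only [l1DirDeriv, Matrix.smul_apply, smul_eq_mul, absDirDeriv_mul hc,
        ← Finset.mul_sum]
      ring)
    (fun D E => by
      rw [← mul_add]
      refine mul_le_mul_of_nonneg_left ?_ hμ
      simp only [l1DirDeriv, ← Finset.sum_add_distrib]
      exact Finset.sum_le_sum fun a _ => Finset.sum_le_sum fun b _ =>
        absDirDeriv_add_le _ _ _)
    (fun D => by
      have := h D.1 D.2
      change -(Gᵀ * D.1).trace ≤ μ * l1DirDeriv Z D.1
      linarith)
  have hsingle (i : Fin n) (j : Fin p) (x : ℝ) :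
      g (Matrix.single i j x) = x * g (Matrix.single i j 1) := by
    rw [← smul_eq_mul, ← map_smul, Matrix.smul_single, smul_eq_mul, mul_one]
  refine ⟨Matrix.of fun i j => g (Matrix.single i j 1), fun i j => ?_, fun D hD => ?_⟩
  · have hp := hgN (Matrix.single i j 1)
    have hn := hgN (Matrix.single i j (-1))
    rw [hsingle] at hn
    simp only [l1DirDeriv_single, absDirDeriv] at hp hn
    constructor
    · intro hz
      simp only [hz, if_false] at hp hn
      simp only [Matrix.of_apply]
      linarith
    · intro hz
      simp only [hz, if_true, abs_neg, abs_one] at hp hn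
      simp only [Matrix.of_apply]
      exact abs_le.mpr ⟨by linarith, by linarith⟩
  · have hg : g D = -(Gᵀ * D).trace := hgT ⟨D, hD⟩
    have hR : ((Matrix.of fun i j => g (Matrix.single i j 1))ᵀ * D).trace = g D := by
      conv_rhs => rw [Matrix.matrix_eq_sum_single D]
      simp only [map_sum, Matrix.trace, Matrix.diag, Matrix.mul_apply, Matrix.transpose_apply,
        Matrix.of_apply]
      rw [Finset.sum_comm]
      exact Finset.sum_congr rfl fun i _ => Finset.sum_congr rfl fun j _ => by
        rw [hsingle i j (D i j), mul_comm]
    rw [Matrix.transpose_add, Matrix.add_mul, Matrix.trace_add, hR, hg, add_neg_cancel]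

/-- The tangent space of the Stiefel manifold at `Z`. -/
def stiefelTangent {n p : ℕ} (Z : Matrix (Fin n) (Fin p) ℝ) :
    Submodule ℝ (Matrix (Fin n) (Fin p) ℝ) where
  carrier := {D | Dᵀ * Z + Zᵀ * D = 0}
  zero_mem' := by simp
  add_mem' := fun {D E} (hD : _ = _) (hE : _ = _) => by
    change (D + E)ᵀ * Z + Zᵀ * (D + E) = 0
    rw [Matrix.transpose_add, Matrix.add_mul, Matrix.mul_add, add_add_add_comm, hD, hE,
      add_zero]
  smul_mem' := fun c D (hD : _ = _) => by
    change (c • D)ᵀ * Z + Zᵀ * (c • D) = 0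
    rw [Matrix.transpose_smul, Matrix.smul_mul, Matrix.mul_smul, ← smul_add, hD, smul_zero]

lemma eq_zero_of_trace_transpose_mul_self {k l : ℕ} {M : Matrix (Fin k) (Fin l) ℝ}
    (h : (Mᵀ * M).trace = 0) : M = 0 := by
  rw [← Matrix.conjTranspose_eq_transpose_of_trivial] at h
  exact Matrix.trace_conjTranspose_mul_self_eq_zero_iff.mp h

/-- A matrix orthogonal to the tangent space at `Z` has the form `Z * S` with `S` symmetric. -/
lemma normal_of_orthogonal_stiefelTangent {n p : ℕ} {Z E : Matrix (Fin n) (Fin p) ℝ}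
    (hZ : Zᵀ * Z = 1) (h : ∀ D ∈ stiefelTangent Z, (Eᵀ * D).trace = 0) :
    (1 - Z * Zᵀ) * E = 0 ∧ Zᵀ * E = Eᵀ * Z := by
  have hPt : (1 - Z * Zᵀ)ᵀ = 1 - Z * Zᵀ := by simp
  have hZP : Zᵀ * (1 - Z * Zᵀ) = 0 := by
    rw [Matrix.mul_sub, ← Matrix.mul_assoc, hZ]; simp
  have hPZ : (1 - Z * Zᵀ) * Z = 0 := by
    rw [Matrix.sub_mul, Matrix.mul_assoc, hZ]; simp
  have hPP : (1 - Z * Zᵀ) * (1 - Z * Zᵀ) = 1 - Z * Zᵀ := by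
    rw [Matrix.mul_sub, ← Matrix.mul_assoc, hPZ]; simp
  constructor
  · apply eq_zero_of_trace_transpose_mul_self
    rw [Matrix.transpose_mul, hPt, Matrix.mul_assoc, ← Matrix.mul_assoc (1 - Z * Zᵀ), hPP]
    apply h
    change ((1 - Z * Zᵀ) * E)ᵀ * Z + Zᵀ * ((1 - Z * Zᵀ) * E) = 0
    rw [Matrix.transpose_mul, hPt, Matrix.mul_assoc, hPZ, ← Matrix.mul_assoc, hZP]
    simp
  · set K := Zᵀ * E - Eᵀ * Z with hK
    have hKt : Kᵀ = -K := by simp [hK]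
    have hD : (Eᵀ * (Z * K)).trace = 0 := by
      apply h
      change (Z * K)ᵀ * Z + Zᵀ * (Z * K) = 0
      rw [Matrix.transpose_mul, Matrix.mul_assoc, hZ, ← Matrix.mul_assoc, hZ, hKt]
      simp
    rw [← Matrix.mul_assoc] at hD
    have hD' : (Zᵀ * E * K).trace = 0 := by
      rw [← Matrix.trace_transpose, Matrix.transpose_mul, hKt, Matrix.neg_mul,
        Matrix.trace_neg, Matrix.trace_mul_comm]
      simpa using hD
    refine sub_eq_zero.mp (eq_zero_of_trace_transpose_mul_self (M := K) ?_)
    rw [hKt, Matrix.neg_mul, Matrix.trace_neg]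
    nth_rewrite 1 [hK]
    rw [Matrix.sub_mul, Matrix.trace_sub, hD, hD']
    simp

lemma LamW_mul_of_range_eq {n p m : ℕ} {X Z : Matrix (Fin n) (Fin p) ℝ}
    (A : Matrix (Fin n) (Fin m) ℝ) (hZ : Zᵀ * Z = 1) (hcons : X * Xᵀ = Z * Zᵀ) :
    LamW X A * Z = -((1 - Z * Zᵀ) * (A * Aᵀ) * Z) := by
  have hPZ : (1 - Z * Zᵀ) * Z = 0 := by
    rw [Matrix.sub_mul, Matrix.mul_assoc, hZ]; simp
  have hXZ : X * (Xᵀ * Z) = Z := by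
    rw [← Matrix.mul_assoc, hcons, Matrix.mul_assoc, hZ, Matrix.mul_one]
  have hPt : (1 - Z * Zᵀ)ᵀ = 1 - Z * Zᵀ := by simp
  unfold LamW
  rw [hcons, Matrix.transpose_neg, Matrix.transpose_mul, Matrix.transpose_mul, hPt]
  simp only [Matrix.add_mul, Matrix.mul_neg, Matrix.neg_mul, Matrix.mul_assoc, hXZ]
  rw [hPZ]
  simp

/-- at a feasible point of the subspace-splitting model, if `D = 0`
minimizes the proximal-gradient subproblem (built with the masked matrix
`Q = ∑ᵢ (Λᵢ − βᵢ XᵢXᵢᵀ)`) over the tangent space at `Z`, then `Z` is a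
first-order stationary point of the ℓ1-regularized sparse PCA problem. -/
theorem stmt3 {n p d : ℕ} {m : Fin d → ℕ}
    (Z : Matrix (Fin n) (Fin p) ℝ)
    (X : Fin d → Matrix (Fin n) (Fin p) ℝ)
    (A : (i : Fin d) → Matrix (Fin n) (Fin (m i)) ℝ)
    (β : Fin d → ℝ) (η μ : ℝ)
    (hβ : ∀ i, 0 < β i) (hη : 0 < η) (hμ : 0 < μ)
    (hZ : Zᵀ * Z = 1)
    (hX : ∀ i, (X i)ᵀ * X i = 1)
    (hcons : ∀ i, X i * (X i)ᵀ = Z * Zᵀ)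
    -- D = 0 is a minimizer of g over the tangent space at Z,
    -- where Q := ∑ i (Λ(X i; A i) − β i • X i (X i)ᵀ)
    (hmin : ∀ D : Matrix (Fin n) (Fin p) ℝ, Dᵀ * Z + Zᵀ * D = 0 →
      (((∑ i, (LamW (X i) (A i) - β i • (X i * (X i)ᵀ))) * Z)ᵀ * (0 : Matrix (Fin n) (Fin p) ℝ)).trace
          + (1 / (2 * η)) * frob (0 : Matrix (Fin n) (Fin p) ℝ) ^ 2
          + μ * ∑ a, ∑ b, |(Z + 0) a b|
        ≤ (((∑ i, (LamW (X i) (A i) - β i • (X i * (X i)ᵀ))) * Z)ᵀ * D).trace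
          + (1 / (2 * η)) * frob D ^ 2 + μ * ∑ a, ∑ b, |(Z + D) a b|) :
    ∃ R : Matrix (Fin n) (Fin p) ℝ, subdiffL1 μ Z R ∧
      (1 - Z * Zᵀ) * (-((∑ i, A i * (A i)ᵀ) * Z) + R) = 0 ∧ Zᵀ * R = Rᵀ * Z := by
  have hQZ : (∑ i, (LamW (X i) (A i) - β i • (X i * (X i)ᵀ))) * Z
      = -((1 - Z * Zᵀ) * ((∑ i, A i * (A i)ᵀ) * Z)) - (∑ i, β i) • Z := by
    rw [Matrix.sum_mul, ← Matrix.mul_assoc, Matrix.mul_sum, Matrix.sum_mul, Finset.sum_smul,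
      ← Finset.sum_neg_distrib, ← Finset.sum_sub_distrib]
    refine Finset.sum_congr rfl fun i _ => ?_
    rw [Matrix.sub_mul, LamW_mul_of_range_eq (A i) hZ (hcons i), hcons i, Matrix.smul_mul,
      Matrix.mul_assoc Z, hZ, Matrix.mul_one]
  rw [hQZ] at hmin
  set S := (∑ i, A i * (A i)ᵀ) * Z
  set b := ∑ i, β i
  have hfrob (D : Matrix (Fin n) (Fin p) ℝ) : frob D ^ 2 = ∑ i, ∑ j, D i j ^ 2 :=
    Real.sq_sqrt (by positivity)
  obtain ⟨R, hR, horth⟩ := exists_subdiffL1_of_nonneg hμ.le Z _ (stiefelTangent Z)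
    fun D hD => nonneg_dirDeriv_of_isMin hμ.le Z (-((1 - Z * Zᵀ) * S) - b • Z)
      (stiefelTangent Z) (c := 1 / (2 * η))
      (fun D hD => by simpa [hfrob] using hmin D hD) hD
  obtain ⟨hP, hsymm⟩ := normal_of_orthogonal_stiefelTangent hZ horth
  have hPZ : (1 - Z * Zᵀ) * Z = 0 := by
    rw [Matrix.sub_mul, Matrix.mul_assoc, hZ]; simp
  have hZP : Zᵀ * (1 - Z * Zᵀ) = 0 := by
    rw [Matrix.mul_sub, ← Matrix.mul_assoc, hZ]; simp
  have hPP : (1 - Z * Zᵀ) * (1 - Z * Zᵀ) = 1 - Z * Zᵀ := by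
    rw [Matrix.mul_sub, ← Matrix.mul_assoc, hPZ]; simp
  refine ⟨R, hR, ?_, ?_⟩
  · rw [Matrix.mul_add, Matrix.mul_sub, Matrix.mul_neg, ← Matrix.mul_assoc, hPP,
      Matrix.mul_smul, hPZ, smul_zero, sub_zero] at hP
    rw [Matrix.mul_add, Matrix.mul_neg, hP]
  · have hZE : Zᵀ * (-((1 - Z * Zᵀ) * S) - b • Z + R) = -(b • 1) + Zᵀ * R := by
      rw [Matrix.mul_add, Matrix.mul_sub, Matrix.mul_neg, ← Matrix.mul_assoc, hZP,
        Matrix.mul_smul, hZ]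
      simp
    have hEZ := congrArg Matrix.transpose hZE
    rw [Matrix.transpose_mul, Matrix.transpose_transpose] at hEZ
    rw [hZE, hEZ] at hsymm
    simpa using hsymm
end

section
/- Let X, Z ∈ S_{n,p} and σ ∈ [0,1]. (a) If ‖XXᵀ − ZZᵀ‖²_F ≤ 2(1 − σ²), then XᵀZZᵀX − σ²I_p is positive semidefinite (equivalently, every singular value of XᵀZ is at least σ). (b) If XᵀZZᵀX − σ²I_p is positive semidefinite, then ‖(I_n − XXᵀ)ZZᵀX‖²_F ≥ (σ²/2)‖XXᵀ − ZZᵀ‖²_F. -/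
open Matrix BigOperators

theorem frob_sq_eq_trace {n m : ℕ} (A : Matrix (Fin n) (Fin m) ℝ) :
    frob A ^ 2 = (Aᵀ * A).trace := by
  rw [frob, Real.sq_sqrt (by positivity), Finset.sum_comm]
  simp [Matrix.trace, Matrix.mul_apply, sq]

/-- A Gram matrix is bounded above by its trace in the Loewner order. -/
theorem posSemidef_trace_smul_one_sub_gram {n m : ℕ} (B : Matrix (Fin n) (Fin m) ℝ) :
    ((Bᵀ * B).trace • (1 : Matrix (Fin m) (Fin m) ℝ) - Bᵀ * B).PosSemidef := by
  refine PosSemidef.of_dotProduct_mulVec_nonneg ?_ fun x => ?_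
  · simp [IsHermitian, conjTranspose_eq_transpose_of_trivial]
  · have hgram : x ⬝ᵥ (Bᵀ * B) *ᵥ x = ∑ i, (∑ j, B i j * x j) ^ 2 := by
      rw [← mulVec_mulVec, dotProduct_mulVec, vecMul_transpose]
      simp [dotProduct, mulVec, sq]
    have htrace : (Bᵀ * B).trace = ∑ i, ∑ j, B i j ^ 2 := by
      rw [← frob_sq_eq_trace, frob, Real.sq_sqrt (by positivity)]
    have hx : x ⬝ᵥ x = ∑ j, x j ^ 2 := by simp [dotProduct, sq]
    rw [star_trivial, sub_mulVec, dotProduct_sub, smul_mulVec, one_mulVec, dotProduct_smul,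
      hgram, htrace, hx, smul_eq_mul, Finset.sum_mul, sub_nonneg]
    exact Finset.sum_le_sum fun i _ => Finset.sum_mul_sq_le_sq_mul_sq _ _ _

/-- The Gram matrix of `(1 - Z Zᵀ) X`, for `X` and `Z` with orthonormal columns. -/
theorem gram_sub_proj {n p : ℕ} {X Z : Matrix (Fin n) (Fin p) ℝ}
    (hX : Xᵀ * X = 1) (hZ : Zᵀ * Z = 1) :
    (X - Z * (Zᵀ * X))ᵀ * (X - Z * (Zᵀ * X)) = 1 - Xᵀ * (Z * Zᵀ) * X := by
  have hZ' (Y : Matrix (Fin p) (Fin p) ℝ) : Zᵀ * (Z * Y) = Y := by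
    rw [← Matrix.mul_assoc, hZ, Matrix.one_mul]
  simp only [transpose_sub, transpose_mul, transpose_transpose, Matrix.sub_mul, Matrix.mul_sub,
    Matrix.mul_assoc, hX, hZ']
  abel

theorem frob_sq_proj_sub_proj {n p : ℕ} {X Z : Matrix (Fin n) (Fin p) ℝ}
    (hX : Xᵀ * X = 1) (hZ : Zᵀ * Z = 1) :
    frob (X * Xᵀ - Z * Zᵀ) ^ 2 = 2 * (1 - Xᵀ * (Z * Zᵀ) * X).trace := by
  have hidem {Y : Matrix (Fin n) (Fin p) ℝ} (hY : Yᵀ * Y = 1) :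
      (Y * Yᵀ * (Y * Yᵀ)).trace = (1 : Matrix (Fin p) (Fin p) ℝ).trace := by
    rw [Matrix.mul_assoc, ← Matrix.mul_assoc Yᵀ, hY, Matrix.one_mul, trace_mul_comm, hY]
  have hcross : (X * Xᵀ * (Z * Zᵀ)).trace = (Xᵀ * (Z * Zᵀ) * X).trace := by
    rw [Matrix.mul_assoc, trace_mul_comm]
  rw [frob_sq_eq_trace]
  simp only [transpose_sub, transpose_mul, transpose_transpose, Matrix.sub_mul, Matrix.mul_sub,
    trace_sub, hidem hX, hidem hZ, trace_mul_comm (Z * Zᵀ) (X * Xᵀ), hcross]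
  ring

theorem frob_sq_compl_proj_mul {n p : ℕ} {X Z : Matrix (Fin n) (Fin p) ℝ}
    (hX : Xᵀ * X = 1) (hZ : Zᵀ * Z = 1) :
    frob ((1 - X * Xᵀ) * (Z * Zᵀ) * X) ^ 2 =
      (Xᵀ * (Z * Zᵀ) * X * (1 - Xᵀ * (Z * Zᵀ) * X)).trace := by
  have hX' (Y : Matrix (Fin p) (Fin p) ℝ) : Xᵀ * (X * Y) = Y := by
    rw [← Matrix.mul_assoc, hX, Matrix.one_mul]
  have hZ' (Y : Matrix (Fin p) (Fin p) ℝ) : Zᵀ * (Z * Y) = Y := by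
    rw [← Matrix.mul_assoc, hZ, Matrix.one_mul]
  rw [frob_sq_eq_trace]
  congr 1
  simp only [transpose_sub, transpose_mul, transpose_transpose, Matrix.sub_mul,
    Matrix.mul_sub, Matrix.mul_assoc, Matrix.one_mul, Matrix.mul_one, hX', hZ']
  abel

/-- for `X, Z` on the Stiefel manifold and `σ ∈ [0,1]`:
(a) if `‖XXᵀ − ZZᵀ‖²_F ≤ 2(1 − σ²)` then `XᵀZZᵀX − σ²I` is positive semidefinite;
(b) if `XᵀZZᵀX − σ²I` is positive semidefinite then
`‖(I − XXᵀ)ZZᵀX‖²_F ≥ (σ²/2)‖XXᵀ − ZZᵀ‖²_F`. -/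
theorem stmt8 {n p : ℕ} (X Z : Matrix (Fin n) (Fin p) ℝ) (σ : ℝ)
    (hX : Xᵀ * X = 1) (hZ : Zᵀ * Z = 1)
    (hσ0 : 0 ≤ σ) (hσ1 : σ ≤ 1) :
    (frob (X * Xᵀ - Z * Zᵀ) ^ 2 ≤ 2 * (1 - σ ^ 2) →
      (Xᵀ * (Z * Zᵀ) * X - σ ^ 2 • (1 : Matrix (Fin p) (Fin p) ℝ)).PosSemidef)
    ∧ ((Xᵀ * (Z * Zᵀ) * X - σ ^ 2 • (1 : Matrix (Fin p) (Fin p) ℝ)).PosSemidef →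
      frob ((1 - X * Xᵀ) * (Z * Zᵀ) * X) ^ 2
        ≥ (σ ^ 2 / 2) * frob (X * Xᵀ - Z * Zᵀ) ^ 2) := by
  have hgram := gram_sub_proj hX hZ
  rw [frob_sq_proj_sub_proj hX hZ, frob_sq_compl_proj_mul hX hZ]
  set M := Xᵀ * (Z * Zᵀ) * X
  set B := X - Z * (Zᵀ * X)
  constructor
  · intro h
    have hA := posSemidef_trace_smul_one_sub_gram B
    rw [hgram] at hA
    have hgap : ((1 - σ ^ 2 - (1 - M).trace) • (1 : Matrix (Fin p) (Fin p) ℝ)).PosSemidef :=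
      PosSemidef.one.smul (by linarith)
    convert hA.add hgap using 1
    module
  · intro h
    have hconj := (h.mul_mul_conjTranspose_same B).trace_nonneg
    rw [conjTranspose_eq_transpose_of_trivial, Matrix.mul_assoc, trace_mul_comm,
      Matrix.mul_assoc, hgram, Matrix.sub_mul, trace_sub, smul_mul, Matrix.one_mul, trace_smul,
      smul_eq_mul] at hconj
    linarith
end

section
/- Let X ∈ S_{n,p}, A ∈ ℝ^{n×m}, Z ∈ ℝ^{n×p}, and β ∈ ℝ. With W := −P_X A Aᵀ X and Λ := XWᵀ + WXᵀ, it holds that P_X (A Aᵀ + Λ) X = 0; consequently, for H := A Aᵀ + Λ + β ZZᵀ, one has P_X H X = β P_X ZZᵀ X, and in particular ‖P_X H X‖_F = |β|·‖P_X ZZᵀ X‖_F. -/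
open Matrix BigOperators

/-- The Frobenius norm is absolutely homogeneous. -/
theorem frob_smul {n m : ℕ} (β : ℝ) (M : Matrix (Fin n) (Fin m) ℝ) :
    frob (β • M) = |β| * frob M := by
  simp only [frob, Matrix.smul_apply, smul_eq_mul, mul_pow, ← Finset.mul_sum]
  rw [Real.sqrt_mul (sq_nonneg β), Real.sqrt_sq_eq_abs]

/-- If `XᵀX = I`, the projector `I - XXᵀ` annihilates `X`. -/
theorem one_sub_mul_transpose_mul_self {n p : ℕ} {X : Matrix (Fin n) (Fin p) ℝ}
    (hX : Xᵀ * X = 1) : (1 - X * Xᵀ) * X = 0 := by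
  rw [Matrix.sub_mul, Matrix.mul_assoc, hX, Matrix.one_mul, Matrix.mul_one, sub_self]

/-- If `XᵀX = I`, the matrix `I - XXᵀ` is idempotent. -/
theorem one_sub_mul_transpose_idem {n p : ℕ} {X : Matrix (Fin n) (Fin p) ℝ}
    (hX : Xᵀ * X = 1) : (1 - X * Xᵀ) * (1 - X * Xᵀ) = 1 - X * Xᵀ := by
  rw [Matrix.mul_sub, ← Matrix.mul_assoc, one_sub_mul_transpose_mul_self hX, Matrix.zero_mul,
    Matrix.mul_one, sub_zero]

/-- The multiplier `LamW X A` cancels the normal component of `A Aᵀ X`. -/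
theorem proj_mul_add_LamW_mul {n p m : ℕ} {X : Matrix (Fin n) (Fin p) ℝ}
    (A : Matrix (Fin n) (Fin m) ℝ) (hX : Xᵀ * X = 1) :
    (1 - X * Xᵀ) * (A * Aᵀ + LamW X A) * X = 0 := by
  have hPX := one_sub_mul_transpose_mul_self hX
  have hPP := one_sub_mul_transpose_idem hX
  unfold LamW
  generalize 1 - X * Xᵀ = P at hPX hPP ⊢
  generalize A * Aᵀ = B
  have h : P * (-(P * B * X) * Xᵀ) * X = -(P * B * X) := by
    rw [Matrix.mul_assoc, Matrix.mul_assoc (-(P * B * X)), hX, Matrix.mul_one, Matrix.mul_neg,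
      ← Matrix.mul_assoc, ← Matrix.mul_assoc, hPP]
  rw [Matrix.mul_add, Matrix.mul_add, ← Matrix.mul_assoc P X, hPX, Matrix.zero_mul, zero_add,
    Matrix.add_mul, h, add_neg_cancel]

/-- with `W := −P_X AAᵀX`, `Λ := XWᵀ + WXᵀ`, we have
`P_X(AAᵀ + Λ)X = 0`; hence for `H := AAᵀ + Λ + βZZᵀ`,
`P_X H X = β P_X ZZᵀ X` and `‖P_X H X‖_F = |β|‖P_X ZZᵀ X‖_F`. -/
theorem stmt9 {n p m : ℕ} (X : Matrix (Fin n) (Fin p) ℝ)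
    (A : Matrix (Fin n) (Fin m) ℝ) (Z : Matrix (Fin n) (Fin p) ℝ) (β : ℝ)
    (hX : Xᵀ * X = 1) :
    (1 - X * Xᵀ) * (A * Aᵀ + LamW X A) * X = 0
    ∧ (1 - X * Xᵀ) * (A * Aᵀ + LamW X A + β • (Z * Zᵀ)) * X
        = β • ((1 - X * Xᵀ) * (Z * Zᵀ) * X)
    ∧ frob ((1 - X * Xᵀ) * (A * Aᵀ + LamW X A + β • (Z * Zᵀ)) * X)
        = |β| * frob ((1 - X * Xᵀ) * (Z * Zᵀ) * X) := by
  have h₀ := proj_mul_add_LamW_mul A hX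
  have h₁ : (1 - X * Xᵀ) * (A * Aᵀ + LamW X A + β • (Z * Zᵀ)) * X
      = β • ((1 - X * Xᵀ) * (Z * Zᵀ) * X) := by
    rw [Matrix.mul_add, Matrix.add_mul, h₀, zero_add, Matrix.mul_smul, Matrix.smul_mul]
  exact ⟨h₀, h₁, by rw [h₁, frob_smul]⟩
end

section
/- Let Z, Z⁺ ∈ S_{n,p}, X_i ∈ S_{n,p} and β_i > 0 for i = 1,…,d, μ > 0, and ρ ≥ 1 with β_i ≤ ρβ_j for all i,j. Set Λ_i := Λ(X_i;A_i), Q := ∑_{i=1}^d (Λ_i − β_i X_i X_iᵀ), and q(Y) := ½ tr(Yᵀ Q Y) + μ∑_{i,j}|Y_{ij}|. If q(Z) ≥ q(Z⁺), then for every i = 1,…,d: distp(Z⁺, X_i)² ≤ ρ ∑_{j=1}^d distp(Z, X_j)² + (8/β_i)(√p ‖A‖²_F + μ n p). -/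
open Matrix BigOperators

/-- Projection distance `distp(X,Z) = ‖XXᵀ − ZZᵀ‖_F`. -/
noncomputable def distp {n p : ℕ} (X Z : Matrix (Fin n) (Fin p) ℝ) : ℝ :=
  frob (X * Xᵀ - Z * Zᵀ)

/-- `q(Y) = ½tr(YᵀQY) + μ∑|Y_{ij}|` with the masked matrix
`Q = ∑ᵢ (Λᵢ − βᵢ XᵢXᵢᵀ)`. -/
noncomputable def qfun {n p d : ℕ} {m : Fin d → ℕ} (μ : ℝ) (β : Fin d → ℝ)
    (A : (i : Fin d) → Matrix (Fin n) (Fin (m i)) ℝ)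
    (X : Fin d → Matrix (Fin n) (Fin p) ℝ)
    (Y : Matrix (Fin n) (Fin p) ℝ) : ℝ :=
  (1 / 2 : ℝ) * (Yᵀ * (∑ i, (LamW (X i) (A i) - β i • (X i * (X i)ᵀ))) * Y).trace
    + μ * ∑ a, ∑ b, |Y a b|

section Frobenius

variable {n m p : ℕ}

lemma frob_sq (M : Matrix (Fin n) (Fin m) ℝ) : frob M ^ 2 = (M * Mᵀ).trace := by
  rw [frob, Real.sq_sqrt (by positivity)]
  simp [Matrix.trace, Matrix.mul_apply, sq]

lemma frob_transpose (M : Matrix (Fin n) (Fin m) ℝ) : frob Mᵀ = frob M := by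
  simp only [frob, transpose_apply]
  rw [Finset.sum_comm]

/-- Young's inequality for the Frobenius inner product. -/
lemma abs_two_mul_trace_mul_transpose_le (M N : Matrix (Fin n) (Fin m) ℝ) :
    |2 * (M * Nᵀ).trace| ≤ frob M ^ 2 + frob N ^ 2 := by
  have hsymm : (N * Mᵀ).trace = (M * Nᵀ).trace := by
    rw [← trace_transpose, transpose_mul, transpose_transpose]
  have hsub := frob_sq (M - N)
  have hadd := frob_sq (M + N)
  simp only [transpose_sub, transpose_add, Matrix.sub_mul, Matrix.mul_sub, Matrix.add_mul,
    Matrix.mul_add, trace_sub, trace_add, hsymm, ← frob_sq] at hsub hadd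
  rw [abs_le]
  constructor <;> nlinarith [sq_nonneg (frob (M - N)), sq_nonneg (frob (M + N))]

/-- Pythagoras for the splitting of the rows of `M` along the column space of `X`. -/
lemma frob_mul_sq_add_frob_mul_compl_sq (M : Matrix (Fin m) (Fin n) ℝ)
    {X : Matrix (Fin n) (Fin p) ℝ} (hX : Xᵀ * X = 1) :
    frob (M * X) ^ 2 + frob (M * (1 - X * Xᵀ)) ^ 2 = frob M ^ 2 := by
  have hproj : (1 - X * Xᵀ) * (1 - X * Xᵀ)ᵀ = 1 - X * Xᵀ := by
    have hidem : X * Xᵀ * (X * Xᵀ) = X * Xᵀ := by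
      rw [Matrix.mul_assoc, ← Matrix.mul_assoc Xᵀ, hX, Matrix.one_mul]
    simp [sub_mul, mul_sub, hidem]
  simp only [frob_sq]
  rw [transpose_mul M, transpose_mul M, Matrix.mul_assoc M, ← Matrix.mul_assoc X,
    Matrix.mul_assoc M, ← Matrix.mul_assoc (1 - X * Xᵀ), hproj, ← trace_add, ← Matrix.mul_add,
    ← Matrix.add_mul, add_sub_cancel, Matrix.one_mul]

lemma frob_mul_sq_le (M : Matrix (Fin m) (Fin n) ℝ)
    {X : Matrix (Fin n) (Fin p) ℝ} (hX : Xᵀ * X = 1) :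
    frob (M * X) ^ 2 ≤ frob M ^ 2 := by
  nlinarith [frob_mul_sq_add_frob_mul_compl_sq M hX, sq_nonneg (frob (M * (1 - X * Xᵀ)))]

lemma frob_mul_transpose_sq (M : Matrix (Fin m) (Fin p) ℝ)
    {X : Matrix (Fin n) (Fin p) ℝ} (hX : Xᵀ * X = 1) :
    frob (M * Xᵀ) ^ 2 = frob M ^ 2 := by
  rw [frob_sq, frob_sq, transpose_mul, transpose_transpose, Matrix.mul_assoc,
    ← Matrix.mul_assoc Xᵀ, hX, Matrix.one_mul]

end Frobenius

section Stiefel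

variable {n m p : ℕ}

lemma distp_sq {Z X : Matrix (Fin n) (Fin p) ℝ} (hZ : Zᵀ * Z = 1) (hX : Xᵀ * X = 1) :
    distp Z X ^ 2 = 2 * p - 2 * (Zᵀ * (X * Xᵀ) * Z).trace := by
  have hself : ∀ {Y : Matrix (Fin n) (Fin p) ℝ}, Yᵀ * Y = 1 →
      (Y * Yᵀ * (Y * Yᵀ)).trace = p := by
    intro Y hY
    rw [Matrix.mul_assoc, ← Matrix.mul_assoc Yᵀ, hY, Matrix.one_mul, trace_mul_comm, hY]
    simp
  have hcross : (Z * Zᵀ * (X * Xᵀ)).trace = (Zᵀ * (X * Xᵀ) * Z).trace := by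
    rw [Matrix.mul_assoc, trace_mul_comm]
  rw [distp, frob_sq]
  simp only [transpose_sub, transpose_mul, transpose_transpose, sub_mul, mul_sub, trace_sub,
    hself hZ, hself hX, trace_mul_comm (X * Xᵀ) (Z * Zᵀ), hcross]
  ring

lemma abs_trace_LamW_le {X Z : Matrix (Fin n) (Fin p) ℝ} (A : Matrix (Fin n) (Fin m) ℝ)
    (hX : Xᵀ * X = 1) (hZ : Zᵀ * Z = 1) :
    |(Zᵀ * LamW X A * Z).trace| ≤ frob A ^ 2 := by
  set M := Aᵀ * (1 - X * Xᵀ) * Z with hM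
  set N := Aᵀ * X * Xᵀ * Z with hN
  have htr : (Zᵀ * LamW X A * Z).trace = -(2 * (M * Nᵀ).trace) := by
    have hMN : (M * Nᵀ).trace = (Zᵀ * ((1 - X * Xᵀ) * (A * Aᵀ) * X * Xᵀ) * Z).trace := by
      rw [← trace_transpose, transpose_mul, transpose_transpose, trace_mul_comm, hM, hN]
      simp [Matrix.mul_assoc]
    have hsymm : (Zᵀ * (X * ((1 - X * Xᵀ) * (A * Aᵀ) * X)ᵀ) * Z).trace
        = (Zᵀ * ((1 - X * Xᵀ) * (A * Aᵀ) * X * Xᵀ) * Z).trace := by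
      rw [← trace_transpose]
      simp [Matrix.mul_assoc]
    rw [hMN, LamW, transpose_neg, Matrix.mul_neg, Matrix.neg_mul, Matrix.mul_add, Matrix.add_mul,
      trace_add, Matrix.mul_neg, Matrix.neg_mul, trace_neg, hsymm, Matrix.mul_neg, Matrix.neg_mul,
      trace_neg]
    ring
  rw [htr, abs_neg, ← frob_transpose A, ← frob_mul_sq_add_frob_mul_compl_sq Aᵀ hX]
  have hM_le : frob M ^ 2 ≤ frob (Aᵀ * (1 - X * Xᵀ)) ^ 2 := frob_mul_sq_le _ hZ
  have hN_le : frob N ^ 2 ≤ frob (Aᵀ * X) ^ 2 :=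
    (frob_mul_sq_le _ hZ).trans_eq (frob_mul_transpose_sq _ hX)
  linarith [abs_two_mul_trace_mul_transpose_le M N]

lemma abs_trace_LamW_le_sqrt_mul {X Z : Matrix (Fin n) (Fin p) ℝ}
    (A : Matrix (Fin n) (Fin m) ℝ) (hX : Xᵀ * X = 1) (hZ : Zᵀ * Z = 1) :
    |(Zᵀ * LamW X A * Z).trace| ≤ Real.sqrt p * frob A ^ 2 := by
  rcases Nat.eq_zero_or_pos p with rfl | hp
  · simp [Matrix.trace]
  · have hsqrt : 1 ≤ Real.sqrt p := Real.one_le_sqrt.mpr (by exact_mod_cast hp)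
    nlinarith [abs_trace_LamW_le A hX hZ, sq_nonneg (frob A)]

lemma sum_abs_le_of_transpose_mul_self {Z : Matrix (Fin n) (Fin p) ℝ} (hZ : Zᵀ * Z = 1) :
    ∑ a, ∑ b, |Z a b| ≤ n * p := by
  have hentry : ∀ a b, |Z a b| ≤ 1 := by
    intro a b
    have hcol := congrFun (congrFun hZ b) b
    simp only [Matrix.mul_apply, transpose_apply, one_apply_eq, ← sq] at hcol
    rw [← sq_le_one_iff_abs_le_one, ← hcol]
    exact Finset.single_le_sum (f := fun a => Z a b ^ 2) (fun _ _ => sq_nonneg _)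
      (Finset.mem_univ a)
  calc ∑ a, ∑ b, |Z a b| ≤ ∑ _a : Fin n, ∑ _b : Fin p, (1 : ℝ) :=
        Finset.sum_le_sum fun a _ => Finset.sum_le_sum fun b _ => hentry a b
    _ = n * p := by simp

end Stiefel

lemma qfun_eq {n p d : ℕ} {m : Fin d → ℕ} (μ : ℝ) (β : Fin d → ℝ)
    (A : (i : Fin d) → Matrix (Fin n) (Fin (m i)) ℝ)
    {X : Fin d → Matrix (Fin n) (Fin p) ℝ} {Y : Matrix (Fin n) (Fin p) ℝ}
    (hX : ∀ i, (X i)ᵀ * X i = 1) (hY : Yᵀ * Y = 1) :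
    qfun μ β A X Y = (1 / 2) * ∑ i, (Yᵀ * LamW (X i) (A i) * Y).trace
      - (p / 2) * ∑ i, β i + (1 / 4) * ∑ i, β i * distp Y (X i) ^ 2
      + μ * ∑ a, ∑ b, |Y a b| := by
  rw [qfun, Matrix.mul_sum, Matrix.sum_mul, trace_sum]
  simp only [Finset.mul_sum (s := (Finset.univ : Finset (Fin d))), ← Finset.sum_sub_distrib,
    ← Finset.sum_add_distrib]
  congr 1
  refine Finset.sum_congr rfl fun i _ => ?_
  rw [distp_sq hY (hX i), Matrix.mul_sub, Matrix.sub_mul, trace_sub, Matrix.mul_smul,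
    Matrix.smul_mul, trace_smul, smul_eq_mul]
  ring

/-- if the masked objective `q` does not increase from `Z` to `Z⁺`, the
consensus errors at `Z⁺` are controlled by those at `Z`. -/
theorem stmt12 {n p d : ℕ} {m : Fin d → ℕ}
    (Z Zplus : Matrix (Fin n) (Fin p) ℝ)
    (X : Fin d → Matrix (Fin n) (Fin p) ℝ)
    (A : (i : Fin d) → Matrix (Fin n) (Fin (m i)) ℝ)
    (β : Fin d → ℝ) (μ ρ : ℝ)
    (hZ : Zᵀ * Z = 1) (hZplus : Zplusᵀ * Zplus = 1)
    (hX : ∀ i, (X i)ᵀ * X i = 1)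
    (hβ : ∀ i, 0 < β i) (hμ : 0 < μ)
    (hρ : 1 ≤ ρ) (hρβ : ∀ i j, β i ≤ ρ * β j)
    (hq : qfun μ β A X Z ≥ qfun μ β A X Zplus) :
    ∀ i, distp Zplus (X i) ^ 2
      ≤ ρ * (∑ j, distp Z (X j) ^ 2)
        + (8 / β i) * (Real.sqrt p * (∑ j, frob (A j) ^ 2) + μ * n * p) := by
  intro i
  rw [ge_iff_le, qfun_eq μ β A hX hZ, qfun_eq μ β A hX hZplus] at hq
  have hΛ : ∑ j, (Zᵀ * LamW (X j) (A j) * Z).trace ≤ Real.sqrt p * ∑ j, frob (A j) ^ 2 := by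
    rw [Finset.mul_sum]
    exact Finset.sum_le_sum fun j _ =>
      (le_abs_self _).trans (abs_trace_LamW_le_sqrt_mul (A j) (hX j) hZ)
  have hΛplus : -(Real.sqrt p * ∑ j, frob (A j) ^ 2)
      ≤ ∑ j, (Zplusᵀ * LamW (X j) (A j) * Zplus).trace := by
    rw [Finset.mul_sum, ← Finset.sum_neg_distrib]
    exact Finset.sum_le_sum fun j _ =>
      neg_le_of_abs_le (abs_trace_LamW_le_sqrt_mul (A j) (hX j) hZplus)
  have hℓ : μ * ∑ a, ∑ b, |Z a b| ≤ μ * (n * p) :=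
    mul_le_mul_of_nonneg_left (sum_abs_le_of_transpose_mul_self hZ) hμ.le
  have hℓplus : 0 ≤ μ * ∑ a, ∑ b, |Zplus a b| := by positivity
  have hterm : β i * distp Zplus (X i) ^ 2 ≤ ∑ j, β j * distp Zplus (X j) ^ 2 :=
    Finset.single_le_sum (f := fun j => β j * distp Zplus (X j) ^ 2)
      (fun j _ => mul_nonneg (hβ j).le (sq_nonneg _)) (Finset.mem_univ i)
  have hdist : ∑ j, β j * distp Z (X j) ^ 2 ≤ ρ * β i * ∑ j, distp Z (X j) ^ 2 := by
    rw [Finset.mul_sum]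
    exact Finset.sum_le_sum fun j _ => mul_le_mul_of_nonneg_right (hρβ j i) (sq_nonneg _)
  have hA : 0 ≤ Real.sqrt p * ∑ j, frob (A j) ^ 2 := by positivity
  have hnp : 0 ≤ μ * (n * p) := by positivity
  refine le_of_mul_le_mul_left ?_ (hβ i)
  calc β i * distp Zplus (X i) ^ 2
      ≤ ρ * β i * ∑ j, distp Z (X j) ^ 2
        + 8 * (Real.sqrt p * (∑ j, frob (A j) ^ 2) + μ * n * p) := by linarith
    _ = _ := by
      have := (hβ i).ne'
      field_simp
end

section
/- Let Z⁺ ∈ S_{n,p}, X_i, X_i⁺ ∈ S_{n,p} and β_i > 0 for i = 1,…,d, μ > 0, and ρ ≥ 1. Set Λ_i := Λ(X_i;A_i) and Λ_i⁺ := Λ(X_i⁺;A_i), and assume for each i that ‖Λ_i⁺ − Λ_i‖_F ≤ 4‖A_i‖₂² distp(X_i⁺, X_i) and distp(Z⁺, X_i⁺) ≤ (1/√(2ρd)) distp(Z⁺, X_i). Then L(Z⁺, {X_i⁺}, {Λ_i}) − L(Z⁺, {X_i⁺}, {Λ_i⁺}) ≥ −((√(2ρd) + 1)/(ρd)) ∑_{i=1}^d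 ‖A_i‖₂² distp(Z⁺, X_i)². -/
open Matrix BigOperators

/-- Spectral (operator 2-) norm of a real matrix. -/
noncomputable def spec {n m : ℕ} (A : Matrix (Fin n) (Fin m) ℝ) : ℝ :=
  ‖LinearMap.toContinuousLinearMap (Matrix.toEuclideanLin A)‖

/-- `r(Z) = μ ∑_{i,j} |Z_{ij}|`. -/
noncomputable def rL1 {n p : ℕ} (μ : ℝ) (Z : Matrix (Fin n) (Fin p) ℝ) : ℝ :=
  μ * ∑ i, ∑ j, |Z i j|

/-- The augmented Lagrangian. -/
noncomputable def Lag {n p d : ℕ} {m : Fin d → ℕ} (μ : ℝ) (β : Fin d → ℝ)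
    (A : (i : Fin d) → Matrix (Fin n) (Fin (m i)) ℝ)
    (Z : Matrix (Fin n) (Fin p) ℝ) (X : Fin d → Matrix (Fin n) (Fin p) ℝ)
    (Λ : Fin d → Matrix (Fin n) (Fin n) ℝ) : ℝ :=
  (∑ i, (-(1 / 2 : ℝ) * ((X i)ᵀ * (A i * (A i)ᵀ) * X i).trace
      - (1 / 2 : ℝ) * ((Λ i)ᵀ * (X i * (X i)ᵀ - Z * Zᵀ)).trace
      + (β i / 4) * frob (X i * (X i)ᵀ - Z * Zᵀ) ^ 2))
  + rL1 μ Z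

/-- The Frobenius norm is the Euclidean norm of the vector of entries. -/
theorem frob_eq_norm {n m : ℕ} (A : Matrix (Fin n) (Fin m) ℝ) :
    frob A = ‖WithLp.toLp 2 (fun q : Fin n × Fin m => A q.1 q.2)‖ := by
  simp [frob, EuclideanSpace.norm_eq, Fintype.sum_prod_type]

theorem frob_nonneg {n m : ℕ} (A : Matrix (Fin n) (Fin m) ℝ) : 0 ≤ frob A :=
  Real.sqrt_nonneg _

theorem frob_add_le {n m : ℕ} (A B : Matrix (Fin n) (Fin m) ℝ) :
    frob (A + B) ≤ frob A + frob B := by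
  simp only [frob_eq_norm]
  exact norm_add_le (WithLp.toLp 2 (fun q : Fin n × Fin m => A q.1 q.2))
    (WithLp.toLp 2 (fun q : Fin n × Fin m => B q.1 q.2))

theorem frob_sub_comm {n m : ℕ} (A B : Matrix (Fin n) (Fin m) ℝ) :
    frob (A - B) = frob (B - A) := by
  simp only [frob, Matrix.sub_apply, sub_sq_comm]

theorem trace_transpose_mul_eq_inner {n m : ℕ} (A B : Matrix (Fin n) (Fin m) ℝ) :
    (Aᵀ * B).trace = inner ℝ (WithLp.toLp 2 (fun q : Fin n × Fin m => A q.1 q.2))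
      (WithLp.toLp 2 (fun q : Fin n × Fin m => B q.1 q.2)) := by
  simp only [Matrix.trace, Matrix.diag_apply, Matrix.mul_apply, Matrix.transpose_apply,
    PiLp.inner_apply, Fintype.sum_prod_type]
  rw [Finset.sum_comm]
  simp [mul_comm]

/-- Cauchy–Schwarz for the Frobenius inner product. -/
theorem abs_trace_transpose_mul_le {n m : ℕ} (A B : Matrix (Fin n) (Fin m) ℝ) :
    |(Aᵀ * B).trace| ≤ frob A * frob B := by
  rw [trace_transpose_mul_eq_inner, frob_eq_norm, frob_eq_norm]
  exact abs_real_inner_le_norm _ _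

theorem distp_nonneg {n p : ℕ} (X Z : Matrix (Fin n) (Fin p) ℝ) : 0 ≤ distp X Z :=
  frob_nonneg _

theorem distp_comm {n p : ℕ} (X Z : Matrix (Fin n) (Fin p) ℝ) : distp X Z = distp Z X :=
  frob_sub_comm _ _

theorem distp_triangle {n p : ℕ} (X Y Z : Matrix (Fin n) (Fin p) ℝ) :
    distp X Z ≤ distp X Y + distp Y Z := by
  have h := frob_add_le (X * Xᵀ - Y * Yᵀ) (Y * Yᵀ - Z * Zᵀ)
  rwa [sub_add_sub_cancel] at h

/-- Changing only the multipliers changes the augmented Lagrangian by its linear terms. -/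
theorem Lag_sub_Lag {n p d : ℕ} {m : Fin d → ℕ} (μ : ℝ) (β : Fin d → ℝ)
    (A : (i : Fin d) → Matrix (Fin n) (Fin (m i)) ℝ)
    (Z : Matrix (Fin n) (Fin p) ℝ) (X : Fin d → Matrix (Fin n) (Fin p) ℝ)
    (Λ Λ' : Fin d → Matrix (Fin n) (Fin n) ℝ) :
    Lag μ β A Z X Λ - Lag μ β A Z X Λ' =
      ∑ i, (1 / 2 : ℝ) * ((Λ' i - Λ i)ᵀ * (X i * (X i)ᵀ - Z * Zᵀ)).trace := by
  simp only [Lag, add_sub_add_right_eq_sub, ← Finset.sum_sub_distrib]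
  refine Finset.sum_congr rfl fun i _ => ?_
  rw [Matrix.transpose_sub, Matrix.sub_mul, Matrix.trace_sub]
  ring

/-- lower bound for the Lagrangian change in the multiplier update. -/
theorem stmt16 {n p d : ℕ} {m : Fin d → ℕ}
    (Zplus : Matrix (Fin n) (Fin p) ℝ)
    (X Xplus : Fin d → Matrix (Fin n) (Fin p) ℝ)
    (A : (i : Fin d) → Matrix (Fin n) (Fin (m i)) ℝ)
    (β : Fin d → ℝ) (μ ρ : ℝ)
    (hZplus : Zplusᵀ * Zplus = 1)
    (hX : ∀ i, (X i)ᵀ * X i = 1)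
    (hXplus : ∀ i, (Xplus i)ᵀ * Xplus i = 1)
    (hβ : ∀ i, 0 < β i) (hμ : 0 < μ) (hρ : 1 ≤ ρ)
    (hΛ : ∀ i, frob (LamW (Xplus i) (A i) - LamW (X i) (A i))
      ≤ 4 * spec (A i) ^ 2 * distp (Xplus i) (X i))
    (hcontr : ∀ i, distp Zplus (Xplus i)
      ≤ (1 / Real.sqrt (2 * ρ * d)) * distp Zplus (X i)) :
    Lag μ β A Zplus Xplus (fun i => LamW (X i) (A i))
      - Lag μ β A Zplus Xplus (fun i => LamW (Xplus i) (A i))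
    ≥ -((Real.sqrt (2 * ρ * d) + 1) / (ρ * d))
        * ∑ i, spec (A i) ^ 2 * distp Zplus (X i) ^ 2 := by
  rw [Lag_sub_Lag, ge_iff_le, Finset.mul_sum]
  refine Finset.sum_le_sum fun i _ => ?_
  have hd : (0 : ℝ) < d := by exact_mod_cast i.pos
  have hρd : 0 < 2 * ρ * d := by positivity
  set s := Real.sqrt (2 * ρ * d) with hs
  have hs0 : 0 < s := Real.sqrt_pos.2 hρd
  have hss : s ^ 2 = 2 * ρ * d := Real.sq_sqrt hρd.le
  have hcoef : (s + 1) / (ρ * d) = 2 * (1 / s + 1) * (1 / s) := by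
    have h : ρ * d = s ^ 2 / 2 := by rw [hss]; ring
    rw [h]
    field_simp
    ring
  have hc := hcontr i
  have ht : distp (Xplus i) (X i) ≤ (1 / s + 1) * distp Zplus (X i) := by
    have h := distp_triangle (Xplus i) Zplus (X i)
    rw [distp_comm (Xplus i) Zplus] at h
    linarith
  have hcs := neg_le_of_abs_le (abs_trace_transpose_mul_le
    (LamW (Xplus i) (A i) - LamW (X i) (A i)) (Xplus i * (Xplus i)ᵀ - Zplus * Zplusᵀ))
  have hbound : frob (LamW (Xplus i) (A i) - LamW (X i) (A i)) *
      frob (Xplus i * (Xplus i)ᵀ - Zplus * Zplusᵀ) ≤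
      (4 * spec (A i) ^ 2 * ((1 / s + 1) * distp Zplus (X i))) *
        (1 / s * distp Zplus (X i)) := by
    have hD := distp_nonneg Zplus (X i)
    refine mul_le_mul ((hΛ i).trans ?_) ?_ (frob_nonneg _) (by positivity)
    · exact mul_le_mul_of_nonneg_left ht (by positivity)
    · rw [frob_sub_comm]
      exact hc
  rw [hcoef]
  linarith
end
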